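/- Let T be the free A-module with basis {e_r : r=(r_1,…,r_d) ∈ {1,…,2n}^d}. For 1≤j≤d−1 define operators by: e_r T_j = e_{s_j(r)} if r_j < r_{j+1}; e_r T_j = v² e_r if r_j = r_{j+1}; e_r T_j = (v²−1) e_r + v² e_{s_j(r)} if r_j > r_{j+1}, where s_j(r) swaps the entries r_j and r_{j+1}. Define the operator T_d by: e_r T_d = e_{r'} if r_d ≤ n, and e_r T_d = (v²−1) e_r + v² e_{r'} if r_d ≥ n+1, where r' replaces the last entry r_d by 2n+1−r_d. Then these operators define a right H_{B_d}-module structure on T, i.e., they satisfy (T_i − v²)(T_i + 1) = 0 for all i, the braid relations T_i T_{i+1} T_i = T_{i+1} T_i T_{i+1} (1 ≤ i ≤ d−2), T_i T_j = T_j T_i for |i−j|>1, and T_d T_{d−1} T_d T_{d−1} = T_{d−1} T_d T_{d−1} T_d. -/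

import Mathlib

noncomputable section

/-- `v ∈ 𝒜 = ℤ[v,v⁻¹]`. -/
def vv : LaurentPolynomial ℤ := LaurentPolynomial.T 1

/-- The free `𝒜`-module `𝐓` with basis `e_r`, `r ∈ {1,…,2n}^d`. -/
abbrev TmodC (n d : ℕ) := (Fin d → Fin (2*n)) →₀ LaurentPolynomial ℤ

/-- The value on the basis element `e_r` of the operator acting at a pair of positions
`a < b` (for `T_j`, `a = j`, `b = j+1`). -/
def bop (n d : ℕ) (a b : Fin d) (r : Fin d → Fin (2*n)) : TmodC n d :=
  if r a < r b then Finsupp.single (r ∘ Equiv.swap a b) 1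
  else if r a = r b then Finsupp.single r (vv^2)
  else Finsupp.single r (vv^2 - 1) + Finsupp.single (r ∘ Equiv.swap a b) (vv^2)

/-- The value on the basis element `e_r` of the operator `T_d`:
`e_r ↦ e_{r'}` if `r_d ≤ n`, and `e_r ↦ (v²−1) e_r + v² e_{r'}` if `r_d ≥ n+1`,
where `r'` replaces the last entry `r_d` by `2n+1−r_d`. -/
def tdop (n d : ℕ) (hd : 0 < d) (r : Fin d → Fin (2*n)) : TmodC n d :=
  let ld : Fin d := ⟨d - 1, by omega⟩
  let r' := Function.update r ld (Fin.rev (r ld))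
  if (r ld : ℕ) < n then Finsupp.single r' 1
  else Finsupp.single r (vv^2 - 1) + Finsupp.single r' (vv^2)

/-- The family of operators `T_1, …, T_d` on `𝐓` (`TfamC i` is `T_{i+1}`; the operator
at the last index is `T_d`). -/
def TfamC (n d : ℕ) (hd : 0 < d) (i : Fin d) : Module.End (LaurentPolynomial ℤ) (TmodC n d) :=
  if h : (i : ℕ) + 1 < d then
    (Finsupp.lift (TmodC n d) (LaurentPolynomial ℤ) _) (bop n d i ⟨(i : ℕ) + 1, h⟩)
  else (Finsupp.lift (TmodC n d) (LaurentPolynomial ℤ) _) (tdop n d hd)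

section LocalRelations

variable {R M α : Type*} [CommRing R] [AddCommGroup M] [Module R M] [LinearOrder α]

/-- The effect of a type `A` generator on a basis vector `m` with adjacent entries `a`, `b`,
where `m'` is the basis vector with these entries swapped. -/
def swapTerm (q : R) (a b : α) (m m' : M) : M :=
  if a < b then m' else if a = b then q • m else (q - 1) • m + q • m'

/-- The effect of the last type `B` generator on a basis vector `m` with last entry `a`,
where `m'` is the basis vector with this entry reversed. -/
def revTerm {n : ℕ} (q : R) (a : Fin (2 * n)) (m m' : M) : M :=
  if (a : ℕ) < n then m' else (q - 1) • m + q • m'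

theorem swapTerm_quadratic (q : R) (S : Module.End R M) (F : α → α → M)
    (hS : ∀ a b, S (F a b) = swapTerm q a b (F a b) (F b a)) (a b : α) :
    ((S - q • 1) * (S + 1)) (F a b) = 0 := by
  rcases lt_trichotomy a b with h | rfl | h
  · simp [hS, swapTerm, h, h.not_gt, h.ne']
    module
  · simp [hS, swapTerm]
  · simp [hS, swapTerm, h, h.not_gt, h.ne']
    module

theorem revTerm_quadratic {n : ℕ} (q : R) (S : Module.End R M) (F : Fin (2 * n) → M)
    (hS : ∀ a, S (F a) = revTerm q a (F a) (F a.rev)) (a : Fin (2 * n)) :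
    ((S - q • 1) * (S + 1)) (F a) = 0 := by
  have ha := a.isLt
  by_cases h : (a : ℕ) < n
  · have h' : ¬ (a.rev : ℕ) < n := by rw [Fin.val_rev]; omega
    simp [hS, revTerm, h, h', -Fin.val_rev]
    module
  · have h' : (a.rev : ℕ) < n := by rw [Fin.val_rev]; omega
    simp [hS, revTerm, h, h', -Fin.val_rev]
    module

theorem swapTerm_braid (q : R) (S T : Module.End R M) (F : α → α → α → M)
    (hS : ∀ a b c, S (F a b c) = swapTerm q a b (F a b c) (F b a c))
    (hT : ∀ a b c, T (F a b c) = swapTerm q b c (F a b c) (F a c b)) (a b c : α) :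
    (S * T * S) (F a b c) = (T * S * T) (F a b c) := by
  rcases lt_trichotomy a b with h | h | h <;> rcases lt_trichotomy b c with h' | h' | h' <;>
    rcases lt_trichotomy a c with h'' | h'' | h'' <;>
    first
    | (exfalso; order)
    | (subst_vars; simp [hS, hT, swapTerm, *, ne_of_gt, lt_asymm]; try module)

theorem swapTerm_comm_swapTerm (q : R) (S T : Module.End R M) (F : α → α → α → α → M)
    (hS : ∀ a b c d, S (F a b c d) = swapTerm q a b (F a b c d) (F b a c d))
    (hT : ∀ a b c d, T (F a b c d) = swapTerm q c d (F a b c d) (F a b d c)) (a b c d : α) :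
    (S * T) (F a b c d) = (T * S) (F a b c d) := by
  simp only [Module.End.mul_apply, hS, hT, swapTerm]
  split_ifs <;> simp [hS, hT, swapTerm, *] <;> module

theorem swapTerm_comm_revTerm {n : ℕ} (q : R) (S T : Module.End R M)
    (F : Fin (2 * n) → Fin (2 * n) → Fin (2 * n) → M)
    (hS : ∀ a b c, S (F a b c) = swapTerm q a b (F a b c) (F b a c))
    (hT : ∀ a b c, T (F a b c) = revTerm q c (F a b c) (F a b c.rev)) (a b c : Fin (2 * n)) :
    (S * T) (F a b c) = (T * S) (F a b c) := by
  simp only [Module.End.mul_apply, hS, hT, swapTerm, revTerm]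
  split_ifs <;> simp [hS, hT, swapTerm, revTerm, *] <;> module

theorem swapTerm_revTerm_braid {n : ℕ} (q : R) (S T : Module.End R M)
    (F : Fin (2 * n) → Fin (2 * n) → M)
    (hS : ∀ a b, S (F a b) = swapTerm q a b (F a b) (F b a))
    (hT : ∀ a b, T (F a b) = revTerm q b (F a b) (F a b.rev)) (a b : Fin (2 * n)) :
    (T * S * T * S) (F a b) = (S * T * S * T) (F a b) := by
  have rev_val_lt (x : Fin (2 * n)) : (x.rev : ℕ) < n ↔ ¬ (x : ℕ) < n := by
    rw [Fin.val_rev]; omega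
  have rev_lt : a.rev < b ↔ b.rev < a := Fin.rev_lt_iff
  have lt_rev : b < a.rev ↔ a < b.rev := Fin.lt_rev_iff
  have eq_rev : b = a.rev ↔ a = b.rev := by rw [← Fin.rev_eq_iff, eq_comm]
  by_cases ha : (a : ℕ) < n <;> by_cases hb : (b : ℕ) < n <;>
    rcases lt_trichotomy a b with h | h | h <;>
    rcases lt_trichotomy a b.rev with h' | h' | h' <;>
    first
    | (exfalso; have := Fin.val_rev b; omega)
    | (clear rev_lt lt_rev eq_rev
       subst h'
       simp [hS, hT, swapTerm, revTerm, rev_val_lt, hb, h, h.not_gt, h.ne', -Fin.val_rev]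
       try module)
    | (try subst h
       simp [hS, hT, swapTerm, revTerm, rev_val_lt, rev_lt, lt_rev, eq_rev, *, ne_of_gt,
         lt_asymm, -Fin.val_rev]
       try module)

end LocalRelations

section Operators

variable {n d : ℕ} (hd : 0 < d)

theorem TfamC_single_of_succ {i j : Fin d} (hj : (j : ℕ) = i + 1) (r : Fin d → Fin (2 * n)) :
    TfamC n d hd i (Finsupp.single r 1) = swapTerm (vv ^ 2) (r i) (r j)
      (Finsupp.single r 1) (Finsupp.single (r ∘ Equiv.swap i j) 1) := by
  have h : (i : ℕ) + 1 < d := hj ▸ j.isLt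
  obtain rfl : j = ⟨i + 1, h⟩ := Fin.ext hj
  simp [TfamC, h, bop, swapTerm, -Finsupp.single_mul, -Finsupp.single_sub]

theorem TfamC_single_of_last {i : Fin d} (hi : (i : ℕ) + 1 = d) (r : Fin d → Fin (2 * n)) :
    TfamC n d hd i (Finsupp.single r 1) = revTerm (vv ^ 2) (r i)
      (Finsupp.single r 1) (Finsupp.single (Function.update r i (r i).rev) 1) := by
  have h : (⟨d - 1, by omega⟩ : Fin d) = i := Fin.ext (by simp; omega)
  simp [TfamC, hi, h, tdop, revTerm, -Finsupp.single_mul, -Finsupp.single_sub]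

theorem TmodC_end_ext {f g : Module.End (LaurentPolynomial ℤ) (TmodC n d)}
    (h : ∀ r, f (Finsupp.single r 1) = g (Finsupp.single r 1)) : f = g :=
  Finsupp.lhom_ext' fun r => LinearMap.ext_ring (h r)

theorem TfamC_quadratic (i : Fin d) :
    (TfamC n d hd i - vv ^ 2 • 1) * (TfamC n d hd i + 1) = 0 := by
  refine TmodC_end_ext fun r => ?_
  rw [LinearMap.zero_apply]
  by_cases hi : (i : ℕ) + 1 < d
  · let j : Fin d := ⟨i + 1, hi⟩
    have hij : i ≠ j := Fin.ne_of_val_ne (by simp [j])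
    convert swapTerm_quadratic (vv ^ 2) (TfamC n d hd i)
      (fun a b => Finsupp.single (fun t => if t = i then a else if t = j then b else r t) 1)
      (fun a b => ?_) (r i) (r j) using 3
    · grind
    · rw [TfamC_single_of_succ hd (j := j) rfl]
      congr! 2 <;> grind
  · convert revTerm_quadratic (vv ^ 2) (TfamC n d hd i)
      (fun a => Finsupp.single (Function.update r i a) 1) (fun a => ?_) (r i) using 3
    · simp
    · rw [TfamC_single_of_last hd (by omega)]
      simp

theorem TfamC_braid {i j k : Fin d} (hj : (j : ℕ) = i + 1) (hk : (k : ℕ) = j + 1) :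
    TfamC n d hd i * TfamC n d hd j * TfamC n d hd i
      = TfamC n d hd j * TfamC n d hd i * TfamC n d hd j := by
  refine TmodC_end_ext fun r => ?_
  have hij : i ≠ j := Fin.ne_of_val_ne (by omega)
  have hjk : j ≠ k := Fin.ne_of_val_ne (by omega)
  have hik : i ≠ k := Fin.ne_of_val_ne (by omega)
  convert swapTerm_braid (vv ^ 2) (TfamC n d hd i) (TfamC n d hd j)
    (fun a b c => Finsupp.single
      (fun t => if t = i then a else if t = j then b else if t = k then c else r t) 1)
    (fun a b c => ?_) (fun a b c => ?_) (r i) (r j) (r k) using 3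
  · grind
  · grind
  · rw [TfamC_single_of_succ hd hj]
    congr! 2 <;> grind
  · rw [TfamC_single_of_succ hd hk]
    congr! 2 <;> grind

theorem TfamC_comm {i j : Fin d} (hij : (i : ℕ) + 1 < j) :
    TfamC n d hd i * TfamC n d hd j = TfamC n d hd j * TfamC n d hd i := by
  refine TmodC_end_ext fun r => ?_
  let i' : Fin d := ⟨i + 1, by omega⟩
  have hii' : i ≠ i' := Fin.ne_of_val_ne (by simp [i'])
  have hij' : i ≠ j := Fin.ne_of_val_ne (by omega)
  have hi'j : i' ≠ j := Fin.ne_of_val_ne (by simp [i']; omega)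
  by_cases hj : (j : ℕ) + 1 < d
  · let j' : Fin d := ⟨j + 1, hj⟩
    have hjj' : j ≠ j' := Fin.ne_of_val_ne (by simp [j'])
    have hij'' : i ≠ j' := Fin.ne_of_val_ne (by simp [j']; omega)
    have hi'j' : i' ≠ j' := Fin.ne_of_val_ne (by simp [i', j']; omega)
    convert swapTerm_comm_swapTerm (vv ^ 2) (TfamC n d hd i) (TfamC n d hd j)
      (fun a b c e => Finsupp.single (fun t => if t = i then a else if t = i' then b
        else if t = j then c else if t = j' then e else r t) 1)
      (fun a b c e => ?_) (fun a b c e => ?_) (r i) (r i') (r j) (r j') using 3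
    · grind
    · grind
    · rw [TfamC_single_of_succ hd (j := i') rfl]
      congr! 2 <;> grind
    · rw [TfamC_single_of_succ hd (j := j') rfl]
      congr! 2 <;> grind
  · convert swapTerm_comm_revTerm (vv ^ 2) (TfamC n d hd i) (TfamC n d hd j)
      (fun a b c => Finsupp.single
        (fun t => if t = i then a else if t = i' then b else if t = j then c else r t) 1)
      (fun a b c => ?_) (fun a b c => ?_) (r i) (r i') (r j) using 3
    · grind
    · grind
    · rw [TfamC_single_of_succ hd (j := i') rfl]
      congr! 2 <;> grind
    · rw [TfamC_single_of_last hd (by omega)]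
      congr! 2 <;> grind [Function.update_apply]

theorem TfamC_braid_last {i j : Fin d} (hj : (j : ℕ) = i + 1) (hjd : (j : ℕ) + 1 = d) :
    TfamC n d hd j * TfamC n d hd i * TfamC n d hd j * TfamC n d hd i
      = TfamC n d hd i * TfamC n d hd j * TfamC n d hd i * TfamC n d hd j := by
  refine TmodC_end_ext fun r => ?_
  have hij : i ≠ j := Fin.ne_of_val_ne (by omega)
  convert swapTerm_revTerm_braid (vv ^ 2) (TfamC n d hd i) (TfamC n d hd j)
    (fun a b => Finsupp.single (fun t => if t = i then a else if t = j then b else r t) 1)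
    (fun a b => ?_) (fun a b => ?_) (r i) (r j) using 3
  · grind
  · grind
  · rw [TfamC_single_of_succ hd hj]
    congr! 2 <;> grind
  · rw [TfamC_single_of_last hd hjd]
    congr! 2 <;> grind [Function.update_apply]

end Operators

/-- The operators `T_1,…,T_d` on the type `C` tensor space `𝐓` satisfy the defining
relations of the Iwahori–Hecke algebra of type `B_d`, i.e. they define a right
`H_{B_d}`-module structure on `𝐓`. -/
theorem stmt18 (n d : ℕ) (hn : 0 < n) (hd : 0 < d) :
    (∀ i : Fin d, (TfamC n d hd i - vv^2 • 1) * (TfamC n d hd i + 1) = 0)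
    ∧ (∀ i j : Fin d, (j : ℕ) = (i : ℕ) + 1 → (i : ℕ) + 2 < d →
        TfamC n d hd i * TfamC n d hd j * TfamC n d hd i
          = TfamC n d hd j * TfamC n d hd i * TfamC n d hd j)
    ∧ (∀ i j : Fin d, ((i : ℕ) + 1 < (j : ℕ) ∨ (j : ℕ) + 1 < (i : ℕ)) →
        TfamC n d hd i * TfamC n d hd j = TfamC n d hd j * TfamC n d hd i)
    ∧ (∀ h2 : 2 ≤ d,
        TfamC n d hd ⟨d-1, by omega⟩ * TfamC n d hd ⟨d-2, by omega⟩
            * TfamC n d hd ⟨d-1, by omega⟩ * TfamC n d hd ⟨d-2, by omega⟩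
          = TfamC n d hd ⟨d-2, by omega⟩ * TfamC n d hd ⟨d-1, by omega⟩
            * TfamC n d hd ⟨d-2, by omega⟩ * TfamC n d hd ⟨d-1, by omega⟩) := by
  refine ⟨TfamC_quadratic hd, fun i j hj hi => ?_, fun i j hij => ?_, fun h2 => ?_⟩
  · exact TfamC_braid hd (k := ⟨i + 2, hi⟩) hj (by simp; omega)
  · rcases hij with h | h
    · exact TfamC_comm hd h
    · exact (TfamC_comm hd h).symm
  · exact TfamC_braid_last hd (by simp; omega) (by simp; omega)
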